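/- arXiv:2501.17197 — 2 statements merged into one kernel-verified Lean document; each statement's English description precedes it below -/
import Mathlib

section
/- Let p be a prime, F = 𝔽_p, G a finite group, K a finite field extension of F, and W an indecomposable FG-module. Suppose V is an indecomposable KG-module with V | W ⊗_F K. Then: (i) for every field automorphism σ of K, the twisted module V^σ satisfies V^σ | W ⊗_F K; and (ii) every indecomposable KG-module U with U | W ⊗_F K is isomorphic to V^σ for some field automorphism σ of K. -/
open TensorProduct

/-- Base change of a representation along a (commutative) algebra `k → L`:
the `L`-linear representation of `G` on `V ⊗_k L = L ⊗[k] V`. -/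
noncomputable def repBaseChange {k : Type*} [CommRing k] (L : Type*) [CommRing L] [Algebra k L]
    {G : Type*} [Monoid G] {V : Type*} [AddCommGroup V] [Module k V]
    (ρ : Representation k G V) : Representation L G (L ⊗[k] V) :=
  (Module.End.baseChangeHom k L V).toRingHom.toMonoidHom.comp ρ

/-- Restriction of scalars `Res_K` of a representation along `K ⊆ L`. -/
def repRes (K : Type*) {L : Type*} [CommRing K] [CommRing L] [Algebra K L]
    {G : Type*} [Monoid G] {U : Type*} [AddCommGroup U] [Module K U] [Module L U]
    [IsScalarTower K L U] (ρ : Representation L G U) : Representation K G U where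
  toFun g := (ρ g).restrictScalars K
  map_one' := by ext u; simp
  map_mul' g h := by ext u; simp

/-- Two representations of `G` over `k` are isomorphic iff the corresponding modules over the
group algebra `MonoidAlgebra k G` are linearly equivalent. -/
def RepIso {k : Type*} [CommSemiring k] {G : Type*} [Monoid G]
    {V W : Type*} [AddCommMonoid V] [Module k V] [AddCommMonoid W] [Module k W]
    (ρ : Representation k G V) (τ : Representation k G W) : Prop :=
  Nonempty (ρ.asModule ≃ₗ[MonoidAlgebra k G] τ.asModule)

/-- `ρ | τ` : `ρ` is (isomorphic to) a direct summand of `τ`, i.e. `τ` is the internal direct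
sum of two submodules (over the group algebra `MonoidAlgebra k G`), the first of which is
isomorphic to `ρ`. -/
def RepSummand {k : Type*} [CommSemiring k] {G : Type*} [Monoid G]
    {V W : Type*} [AddCommMonoid V] [Module k V] [AddCommMonoid W] [Module k W]
    (ρ : Representation k G V) (τ : Representation k G W) : Prop :=
  ∃ A B : Submodule (MonoidAlgebra k G) τ.asModule,
    IsCompl A B ∧ Nonempty (ρ.asModule ≃ₗ[MonoidAlgebra k G] A)

/-- A representation is indecomposable if it is nonzero and the corresponding module over the
group algebra is not the internal direct sum of two nonzero submodules. -/
def RepIndecomposable {k : Type*} [CommSemiring k] {G : Type*} [Monoid G]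
    {V : Type*} [AddCommMonoid V] [Module k V] (ρ : Representation k G V) : Prop :=
  Nontrivial V ∧
    ∀ A B : Submodule (MonoidAlgebra k G) ρ.asModule, IsCompl A B → A = ⊥ ∨ B = ⊥

/-- A representation is simple if the corresponding module over the group algebra is simple. -/
def RepSimple {k : Type*} [CommRing k] {G : Type*} [Monoid G]
    {V : Type*} [AddCommGroup V] [Module k V] (ρ : Representation k G V) : Prop :=
  IsSimpleModule (MonoidAlgebra k G) ρ.asModule

/-- Type synonym: `V` with the `K`-scalar multiplication twisted by `σ : K →+* K`. -/
def TwistBy {K : Type*} [CommSemiring K] (_σ : K →+* K) (V : Type*) : Type _ := V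

instance {K : Type*} [CommSemiring K] (σ : K →+* K) (V : Type*) [AddCommMonoid V] :
    AddCommMonoid (TwistBy σ V) := inferInstanceAs (AddCommMonoid V)

instance {K : Type*} [CommSemiring K] (σ : K →+* K) (V : Type*) [AddCommMonoid V]
    [Module K V] : Module K (TwistBy σ V) := Module.compHom V σ

/-- The twist `V^σ` of a representation by an endomorphism `σ` of the coefficient ring:
`G` acts as before, but scalars act through `σ`; equivalently, this is restriction of scalars
along the endomorphism of `MonoidAlgebra K G` applying `σ` to coefficients. -/
def repTwist {K : Type*} [CommSemiring K] {G : Type*} [Monoid G]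
    {V : Type*} [AddCommMonoid V] [Module K V] (ρ : Representation K G V) (σ : K →+* K) :
    Representation K G (TwistBy σ V) where
  toFun g :=
    { toFun := fun v => (ρ g) v
      map_add' := (ρ g).map_add
      map_smul' := fun a v => (ρ g).map_smul (σ a) v }
  map_one' := by
    ext v
    exact LinearMap.congr_fun ρ.map_one v
  map_mul' g h := by
    ext v
    exact LinearMap.congr_fun (ρ.map_mul g h) v

section Indecomposable

variable {R M N : Type*} [Ring R] [AddCommGroup M] [Module R M] [AddCommGroup N] [Module R N]

/-- A retraction of linear maps splits its target. -/
theorem LinearMap.isCompl_range_ker_of_comp_eq_id {i : M →ₗ[R] N} {q : N →ₗ[R] M}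
    (h : q ∘ₗ i = LinearMap.id) : IsCompl (LinearMap.range i) (LinearMap.ker q) := by
  have hi : ∀ x, q (i x) = x := fun x => LinearMap.congr_fun h x
  rw [isCompl_iff, Submodule.disjoint_def, codisjoint_iff, Submodule.eq_top_iff']
  refine ⟨?_, fun y => Submodule.mem_sup.2 ⟨i (q y), ⟨q y, rfl⟩, y - i (q y), ?_, by abel⟩⟩
  · rintro _ ⟨x, rfl⟩ hx
    rw [LinearMap.mem_ker, hi] at hx
    rw [hx, map_zero]
  · rw [LinearMap.mem_ker, map_sub, hi, sub_self]

/-- Up to isomorphism, the complemented submodules are exactly the retracts. -/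
theorem exists_isCompl_equiv_iff_exists_comp_eq_id :
    (∃ A B : Submodule R N, IsCompl A B ∧ Nonempty (M ≃ₗ[R] A)) ↔
      ∃ (i : M →ₗ[R] N) (q : N →ₗ[R] M), q ∘ₗ i = LinearMap.id := by
  constructor
  · rintro ⟨A, B, hAB, ⟨e⟩⟩
    refine ⟨A.subtype ∘ₗ e, e.symm ∘ₗ A.projectionOnto B hAB, ?_⟩
    ext x
    simp
  · rintro ⟨i, q, h⟩
    refine ⟨_, _, LinearMap.isCompl_range_ker_of_comp_eq_id h,
      ⟨LinearEquiv.ofInjective i (Function.LeftInverse.injective (g := q) fun x => ?_)⟩⟩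
    exact LinearMap.congr_fun h x

/-- A linear map that splits, out of a nonzero module into an indecomposable module, is
bijective. -/
theorem LinearMap.bijective_of_comp_eq_id [Nontrivial M]
    (hN : ∀ A B : Submodule R N, IsCompl A B → A = ⊥ ∨ B = ⊥)
    {i : M →ₗ[R] N} {q : N →ₗ[R] M} (h : q ∘ₗ i = LinearMap.id) : Function.Bijective i := by
  have hinj : Function.Injective i :=
    Function.LeftInverse.injective (g := q) fun x => LinearMap.congr_fun h x
  have hc := LinearMap.isCompl_range_ker_of_comp_eq_id h
  refine ⟨hinj, ?_⟩
  rcases hN _ _ hc with h0 | h0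
  · rw [LinearMap.range_eq_bot] at h0
    obtain ⟨x, hx⟩ := exists_ne (0 : M)
    exact absurd (hinj (by rw [h0]; rfl)) hx
  · rw [h0] at hc
    exact LinearMap.range_eq_top.1 (eq_top_of_isCompl_bot hc)

/-- **Fitting's lemma**: the endomorphism ring of an indecomposable module of finite length is
local. -/
theorem isLocalRing_end_of_indecomposable [Nontrivial M] [IsArtinian R M] [IsNoetherian R M]
    (hM : ∀ A B : Submodule R M, IsCompl A B → A = ⊥ ∨ B = ⊥) :
    IsLocalRing (Module.End R M) where
  isUnit_or_isUnit_of_add_one {a b} hab := by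
    obtain ⟨n, hc, hn⟩ := (a.eventually_isCompl_ker_pow_range_pow.and
      (Filter.eventually_ge_atTop 1)).exists
    rcases hM _ _ hc with h0 | h0
    · left
      rw [h0] at hc
      have hu : IsUnit (a ^ n) := (Module.End.isUnit_iff _).2
        ⟨LinearMap.ker_eq_bot.1 h0, LinearMap.range_eq_top.1 (eq_top_of_isCompl_bot hc.symm)⟩
      exact (isUnit_pow_iff (by omega)).1 hu
    · right
      rw [LinearMap.range_eq_bot] at h0
      rw [← eq_sub_iff_add_eq'] at hab
      rw [hab]
      exact IsNilpotent.isUnit_one_sub ⟨n, h0⟩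

/-- If the identity of an indecomposable module of finite length is a sum of maps factoring
through indecomposable modules, then it is isomorphic to one of the latter. -/
theorem exists_bijective_of_sum_comp_eq_id [Nontrivial M] [IsArtinian R M] [IsNoetherian R M]
    (hM : ∀ A B : Submodule R M, IsCompl A B → A = ⊥ ∨ B = ⊥)
    {ι : Type*} [Fintype ι] {Y : ι → Type*} [∀ j, AddCommGroup (Y j)] [∀ j, Module R (Y j)]
    (hY : ∀ j, ∀ A B : Submodule R (Y j), IsCompl A B → A = ⊥ ∨ B = ⊥)
    (f : ∀ j, M →ₗ[R] Y j) (g : ∀ j, Y j →ₗ[R] M)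
    (h : ∀ x, ∑ j, g j (f j x) = x) : ∃ j, Function.Bijective (f j) := by
  have := isLocalRing_end_of_indecomposable hM
  have hs : ∑ j, (g j ∘ₗ f j : Module.End R M) = 1 := by
    ext x
    simpa using h x
  obtain ⟨j, -, u, hu⟩ := IsLocalRing.exists_of_isUnit_sum (hs ▸ isUnit_one)
  refine ⟨j, LinearMap.bijective_of_comp_eq_id (hY j)
    (q := (↑u⁻¹ : Module.End R M) ∘ₗ g j) ?_⟩
  rw [LinearMap.comp_assoc, ← hu]
  exact u.inv_mul

/-- A nonzero artinian module has an indecomposable direct summand. -/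
theorem exists_isCompl_indecomposable [Nontrivial M] [IsArtinian R M] :
    ∃ A B : Submodule R M, IsCompl A B ∧ A ≠ ⊥ ∧
      ∀ C D : Submodule R A, IsCompl C D → C = ⊥ ∨ D = ⊥ := by
  obtain ⟨A, ⟨hA, B, hAB⟩, hmin⟩ := wellFounded_lt.has_min
    {A : Submodule R M | A ≠ ⊥ ∧ ∃ B, IsCompl A B} ⟨⊤, top_ne_bot, ⊥, isCompl_top_bot⟩
  refine ⟨A, B, hAB, hA, fun C D hCD => ?_⟩
  by_contra! hne
  have hr : (C.projectionOnto D hCD ∘ₗ A.projectionOnto B hAB) ∘ₗ (A.subtype ∘ₗ C.subtype) =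
      LinearMap.id := by
    ext x
    simp
  have hc := LinearMap.isCompl_range_ker_of_comp_eq_id hr
  rw [LinearMap.range_comp, Submodule.range_subtype] at hc
  refine hmin _ ⟨?_, _, hc⟩ ?_
  · exact fun h => hne.1 (Submodule.map_injective_of_injective A.injective_subtype
      (h.trans (Submodule.map_bot _).symm))
  · refine lt_of_le_of_ne (Submodule.map_subtype_le A C) fun heq => hne.2 ?_
    have : C = ⊤ := by
      apply Submodule.map_injective_of_injective A.injective_subtype
      rw [heq, Submodule.map_subtype_top]
    rw [this] at hCD
    exact eq_bot_of_isCompl_top hCD.symm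

end Indecomposable

section Representation

open Representation

variable {k G V W U : Type*} [CommRing k] [Monoid G] [AddCommGroup V] [Module k V]
  [AddCommGroup W] [Module k W] [AddCommGroup U] [Module k U]

theorem repSummand_iff {ρ : Representation k G V} {τ : Representation k G W} :
    RepSummand ρ τ ↔ ∃ (i : IntertwiningMap ρ τ) (q : IntertwiningMap τ ρ), ∀ v, q (i v) = v := by
  refine (exists_isCompl_equiv_iff_exists_comp_eq_id (M := ρ.asModule) (N := τ.asModule)).trans
    ⟨?_, ?_⟩
  · rintro ⟨i, q, h⟩
    exact ⟨(IntertwiningMap.equivLinearMapAsModule ρ τ).symm i,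
      (IntertwiningMap.equivLinearMapAsModule τ ρ).symm q, LinearMap.congr_fun h⟩
  · rintro ⟨i, q, h⟩
    exact ⟨IntertwiningMap.equivLinearMapAsModule ρ τ i,
      IntertwiningMap.equivLinearMapAsModule τ ρ q, LinearMap.ext h⟩

theorem repIndecomposable_iff {ρ : Representation k G V} :
    RepIndecomposable ρ ↔ Nontrivial V ∧ ∀ e : IntertwiningMap ρ ρ, (∀ v, e (e v) = e v) →
      (∀ v, e v = 0) ∨ ∀ v, e v = v := by
  refine and_congr_right fun _ => ⟨fun h e he => ?_, fun h A B hAB => ?_⟩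
  · let f : Module.End (MonoidAlgebra k G) ρ.asModule := IntertwiningMap.equivLinearMapAsModule ρ ρ e
    have hf : IsIdempotentElem f := LinearMap.ext he
    rcases h _ _ (LinearMap.IsIdempotentElem.isCompl hf) with h0 | h0
    · left
      exact LinearMap.congr_fun (LinearMap.range_eq_bot.1 h0)
    · right
      exact fun v => LinearMap.ker_eq_bot.1 h0 (he v)
  · let e := (IntertwiningMap.equivLinearMapAsModule ρ ρ).symm (A.projection B hAB)
    rcases h e fun v => LinearMap.congr_fun (Submodule.isIdempotentElem_projection hAB) v
      with h0 | h0
    · left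
      rw [← Submodule.range_projection hAB, LinearMap.range_eq_bot]
      exact LinearMap.ext h0
    · right
      rw [← Submodule.ker_projection hAB, LinearMap.ker_eq_bot]
      exact fun x y hxy => (h0 x).symm.trans (hxy.trans (h0 y))

instance {K : Type*} [CommSemiring K] (σ : K →+* K) (V : Type*) [AddCommGroup V] :
    AddCommGroup (TwistBy σ V) := inferInstanceAs (AddCommGroup V)

theorem RepIndecomposable.twist {K : Type*} [CommRing K] [Module K V]
    {ρ : Representation K G V} (h : RepIndecomposable ρ) (σ : K ≃+* K) :
    RepIndecomposable (repTwist ρ σ.toRingHom) := by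
  rw [repIndecomposable_iff] at h ⊢
  refine ⟨h.1, fun e he => ?_⟩
  let f : V → V := fun v => e v
  have hsmul : ∀ (a : K) (v : V), f (a • v) = a • f v := fun a v => by
    have : f (σ (σ.symm a) • v) = σ (σ.symm a) • f v := e.toLinearMap.map_smul (σ.symm a) v
    simpa using this
  exact h.2 ⟨⟨⟨f, fun v w => e.toLinearMap.map_add v w⟩, hsmul⟩,
    fun g => LinearMap.ext fun v => e.isIntertwining _ _ g v⟩ he

end Representation

section Galois

open Representation

variable {F K G V W : Type*} [Field F] [Field K] [Algebra F K] [Monoid G]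
  [AddCommGroup W] [Module F W] [AddCommGroup V] [Module K V]

/-- The conjugation `σ ⊗ 1` on `K ⊗ W`. -/
noncomputable def galConj (W : Type*) [AddCommGroup W] [Module F W] (σ : K ≃ₐ[F] K) :
    K ⊗[F] W →ₗ[F] K ⊗[F] W :=
  σ.toLinearMap.rTensor W

@[simp]
theorem galConj_tmul (σ : K ≃ₐ[F] K) (a : K) (w : W) :
    galConj W σ (a ⊗ₜ w) = σ a ⊗ₜ w := rfl

theorem galConj_smul (σ : K ≃ₐ[F] K) (a : K) (z : K ⊗[F] W) :
    galConj W σ (a • z) = σ a • galConj W σ z := by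
  induction z with
  | zero => simp
  | tmul b w => simp [TensorProduct.smul_tmul']
  | add x y hx hy => rw [smul_add, map_add, hx, hy, map_add, smul_add]

@[simp]
theorem galConj_symm_galConj (σ : K ≃ₐ[F] K) (z : K ⊗[F] W) :
    galConj W σ.symm (galConj W σ z) = z := by
  induction z with
  | zero => simp
  | tmul b w => simp
  | add x y hx hy => rw [map_add, map_add, hx, hy]

@[simp]
theorem galConj_galConj_symm (σ : K ≃ₐ[F] K) (z : K ⊗[F] W) :
    galConj W σ (galConj W σ.symm z) = z :=
  galConj_symm_galConj σ.symm z

@[simp]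
theorem repBaseChange_tmul (ρ : Representation F G W) (g : G) (a : K) (w : W) :
    repBaseChange K ρ g (a ⊗ₜ w) = a ⊗ₜ ρ g w := rfl

theorem galConj_repBaseChange (ρ : Representation F G W) (σ : K ≃ₐ[F] K) (g : G)
    (z : K ⊗[F] W) :
    galConj W σ (repBaseChange K ρ g z) = repBaseChange K ρ g (galConj W σ z) := by
  induction z with
  | zero => simp
  | tmul b w => simp
  | add x y hx hy => rw [map_add, map_add, hx, hy, map_add, map_add]

/-- Conjugating a map into a base change gives a map out of the twist. -/
noncomputable def conjInto {ρ : Representation F G W} {τ : Representation K G V}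
    (σ : K ≃ₐ[F] K) (i : IntertwiningMap τ (repBaseChange K ρ)) :
    IntertwiningMap (repTwist τ σ.toRingEquiv.toRingHom) (repBaseChange K ρ) where
  toFun v := galConj W σ.symm (i.toLinearMap v)
  map_add' v w := (congrArg (galConj W σ.symm) (i.toLinearMap.map_add v w)).trans (map_add _ _ _)
  map_smul' a v := by
    refine (congrArg (galConj W σ.symm) (i.toLinearMap.map_smul (σ a) v)).trans ?_
    rw [galConj_smul, AlgEquiv.symm_apply_apply]
    rfl
  isIntertwining' g := LinearMap.ext fun v =>
    (congrArg (galConj W σ.symm) (i.isIntertwining _ _ g v)).trans (galConj_repBaseChange _ _ _ _)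

/-- Conjugating a map out of a base change gives a map into the twist. -/
noncomputable def conjFrom {ρ : Representation F G W} {τ : Representation K G V}
    (σ : K ≃ₐ[F] K) (q : IntertwiningMap (repBaseChange K ρ) τ) :
    IntertwiningMap (repBaseChange K ρ) (repTwist τ σ.toRingEquiv.toRingHom) where
  toFun z := q.toLinearMap (galConj W σ z)
  map_add' y z := (congrArg q.toLinearMap (map_add _ y z)).trans (map_add _ _ _)
  map_smul' a z := (congrArg q.toLinearMap (galConj_smul σ a z)).trans
    (q.toLinearMap.map_smul (σ a) _)
  isIntertwining' g := LinearMap.ext fun z =>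
    (congrArg q.toLinearMap (galConj_repBaseChange ρ σ g z)).trans (q.isIntertwining _ _ g _)

/-- Direct summands of a representation realized over the ground field are stable under twisting. -/
theorem RepSummand.twist {ρ : Representation F G W} {τ : Representation K G V}
    (h : RepSummand τ (repBaseChange K ρ)) (σ : K ≃ₐ[F] K) :
    RepSummand (repTwist τ σ.toRingEquiv.toRingHom) (repBaseChange K ρ) := by
  obtain ⟨i, q, hiq⟩ := repSummand_iff.1 h
  refine repSummand_iff.2 ⟨conjInto σ i, conjFrom σ q, fun v => ?_⟩
  exact (congrArg q.toLinearMap (galConj_galConj_symm σ _)).trans (hiq v)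

variable [Module F V] [IsScalarTower F K V]

/-- An indecomposable representation is a retract of the restriction to the ground field of any
nonzero summand of its base change. -/
theorem exists_retract_repRes [Nontrivial V] [FiniteDimensional F K] [FiniteDimensional F V]
    {ρ : Representation F G W} {τ : Representation K G V}
    (hρ : RepIndecomposable ρ) (h : RepSummand τ (repBaseChange K ρ)) :
    ∃ (f : IntertwiningMap ρ (repRes F τ)) (g : IntertwiningMap (repRes F τ) ρ),
      ∀ w, g (f w) = w := by
  obtain ⟨i, q, hiq⟩ := repSummand_iff.1 h
  let b := Module.finBasis F K
  let R := MonoidAlgebra F G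
  let N := (repRes F τ).asModule
  have : Nontrivial N := inferInstanceAs (Nontrivial V)
  have : FiniteDimensional F N := inferInstanceAs (FiniteDimensional F V)
  have : IsArtinian R N := isArtinian_of_tower F inferInstance
  have : IsNoetherian R N := isNoetherian_of_tower F inferInstance
  let α (j) : N →ₗ[R] ρ.asModule := IntertwiningMap.equivLinearMapAsModule (repRes F τ) ρ
    { toLinearMap := TensorProduct.lid F W ∘ₗ (b.coord j).rTensor W ∘ₗ
        i.toLinearMap.restrictScalars F
      isIntertwining' := fun g => by
        ext v
        change TensorProduct.lid F W ((b.coord j).rTensor W (i (τ g v))) =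
          ρ g (TensorProduct.lid F W ((b.coord j).rTensor W (i v)))
        rw [i.isIntertwining]
        generalize i v = z
        induction z with
        | zero => simp
        | tmul c w => simp
        | add x y hx hy => simp only [map_add, hx, hy] }
  let β (j) : ρ.asModule →ₗ[R] N := IntertwiningMap.equivLinearMapAsModule ρ (repRes F τ)
    { toLinearMap := q.toLinearMap.restrictScalars F ∘ₗ TensorProduct.mk F K W (b j)
      isIntertwining' := fun g => by
        ext w
        exact q.isIntertwining _ _ g (b j ⊗ₜ w) }
  have hβα (v : N) : ∑ j, β j (α j v) = v := by
    have key (z : K ⊗[F] W) :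
        ∑ j, b j ⊗ₜ[F] TensorProduct.lid F W ((b.coord j).rTensor W z) = z := by
      induction z with
      | zero => simp
      | tmul c w =>
        simp only [LinearMap.rTensor_tmul, TensorProduct.lid_tmul, ← TensorProduct.smul_tmul,
          ← TensorProduct.sum_tmul, Module.Basis.coord_apply, b.sum_repr]
      | add x y hx hy =>
        simp only [map_add, TensorProduct.tmul_add, Finset.sum_add_distrib, hx, hy]
    have h1 := congrArg q.toLinearMap (key (i v))
    rw [map_sum] at h1
    exact h1.trans (hiq v)
  obtain ⟨A, B, hAB, hA, hAi⟩ := exists_isCompl_indecomposable (R := R) (M := N)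
  have : Nontrivial A := Submodule.nontrivial_iff_ne_bot.2 hA
  obtain ⟨j, hj⟩ := exists_bijective_of_sum_comp_eq_id hAi (fun _ => hρ.2)
    (fun j => α j ∘ₗ A.subtype) (fun j => A.projectionOnto B hAB ∘ₗ β j) fun x => by
      simp only [LinearMap.comp_apply, ← map_sum, hβα]
      simp
  let e := LinearEquiv.ofBijective _ hj
  refine ⟨(IntertwiningMap.equivLinearMapAsModule ρ (repRes F τ)).symm (A.subtype ∘ₗ e.symm),
    (IntertwiningMap.equivLinearMapAsModule (repRes F τ) ρ).symm
      (e ∘ₗ A.projectionOnto B hAB), fun w => ?_⟩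
  change e (A.projectionOnto B hAB (e.symm w : A)) = w
  rw [Submodule.projectionOnto_apply_left]
  exact e.apply_symm_apply w

/-- If `ρ` is a retract of the restriction of `τ` to the ground field, then the identity of the
base change of `ρ` is a sum of maps factoring through the Galois twists of `τ`. -/
theorem exists_sum_conj_eq [FiniteDimensional F K] [IsGalois F K]
    {ρ : Representation F G W} {τ : Representation K G V}
    (f : IntertwiningMap ρ (repRes F τ)) (g : IntertwiningMap (repRes F τ) ρ)
    (hgf : ∀ w, g (f w) = w) :
    ∃ (i : IntertwiningMap τ (repBaseChange K ρ)) (q : IntertwiningMap (repBaseChange K ρ) τ),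
      ∀ z, ∑ σ : K ≃ₐ[F] K, galConj W σ.symm (i (q (galConj W σ z))) = z := by
  classical
  let b := Module.finBasis F K
  let d := b.traceDual
  have hd (x : K) : ∑ j, Algebra.trace F K (x * b j) • d j = x := by
    have h1 := b.traceDual.sum_repr x
    simp only [Module.Basis.traceDual_repr_apply, Algebra.traceForm_apply] at h1
    exact h1
  have hb (x : K) : ∑ j, Algebra.trace F K (x * d j) • b j = x := by
    have h1 := b.traceDual.traceDual.sum_repr x
    simp only [Module.Basis.traceDual_repr_apply, Algebra.traceForm_apply] at h1
    simpa using h1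
  let i : IntertwiningMap τ (repBaseChange K ρ) :=
    { toFun := fun v => ∑ j, b j ⊗ₜ g.toLinearMap (d j • v)
      map_add' := fun v w => by
        simp [TensorProduct.tmul_add, Finset.sum_add_distrib]
      map_smul' := fun c v => by
        have h1 (j) : b j ⊗ₜ[F] g.toLinearMap (d j • c • v) =
            ∑ l, (Algebra.trace F K (d j * c * b l) • b j) ⊗ₜ[F] g.toLinearMap (d l • v) := by
          conv_lhs => rw [smul_smul, ← hd (d j * c), Finset.sum_smul, map_sum,
            TensorProduct.tmul_sum]
          refine Finset.sum_congr rfl fun l _ => ?_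
          rw [smul_assoc, map_smul, TensorProduct.smul_tmul]
        simp only [h1]
        rw [Finset.sum_comm, RingHom.id_apply, Finset.smul_sum]
        refine Finset.sum_congr rfl fun l _ => ?_
        rw [← TensorProduct.sum_tmul, TensorProduct.smul_tmul', smul_eq_mul]
        congr 1
        conv_rhs => rw [← hb (c * b l)]
        exact Finset.sum_congr rfl fun j _ => by congr 2; ring
      isIntertwining' := fun x => by
        ext v
        change ∑ j, b j ⊗ₜ g.toLinearMap (d j • τ x v) =
          repBaseChange K ρ x (∑ j, b j ⊗ₜ g.toLinearMap (d j • v))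
        rw [map_sum]
        refine Finset.sum_congr rfl fun j _ => ?_
        rw [repBaseChange_tmul, ← map_smul]
        exact congrArg _ (g.isIntertwining _ _ x (d j • v)) }
  let q : IntertwiningMap (repBaseChange K ρ) τ :=
    { toLinearMap := LinearMap.liftBaseChange K f.toLinearMap
      isIntertwining' := fun x => by
        ext w
        simpa using show f (ρ x w) = τ x (f w) from f.isIntertwining _ _ x w }
  refine ⟨i, q, fun z => ?_⟩
  induction z with
  | zero => simp
  | add x y hx hy => simp only [map_add, Finset.sum_add_distrib, hx, hy]
  | tmul a w =>
    have hi (v : V) : i v = ∑ j, b j ⊗ₜ g.toLinearMap (d j • v) := rfl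
    have hq (c : K) : q (c ⊗ₜ w) = c • f w := LinearMap.liftBaseChange_tmul ..
    have h1 (σ : K ≃ₐ[F] K) : galConj W σ.symm (i (q (galConj W σ (a ⊗ₜ w)))) =
        a • ∑ j, σ.symm (b j) ⊗ₜ g.toLinearMap (d j • f w) := by
      rw [galConj_tmul, hq, map_smul, galConj_smul, AlgEquiv.symm_apply_apply, hi, map_sum]
      rfl
    have h2 (x : K) : ∑ σ : K ≃ₐ[F] K, σ.symm x = algebraMap F K (Algebra.trace F K x) := by
      rw [trace_eq_sum_automorphisms]
      exact Equiv.sum_comp (Equiv.inv (K ≃ₐ[F] K)) fun σ => σ x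
    simp only [h1]
    rw [← Finset.smul_sum, Finset.sum_comm]
    simp only [← TensorProduct.sum_tmul, h2, Algebra.algebraMap_eq_smul_one,
      TensorProduct.smul_tmul, ← map_smul, ← smul_assoc]
    rw [← TensorProduct.tmul_sum, ← map_sum, ← Finset.sum_smul]
    have h3 := hd 1
    simp only [one_mul] at h3
    rw [h3, one_smul, TensorProduct.smul_tmul', smul_eq_mul, mul_one]
    exact congrArg _ (hgf w)

/-- Every indecomposable summand of the base change of an indecomposable representation is a
Galois twist of any given indecomposable summand. -/
theorem exists_repIso_twist [FiniteDimensional F K] [IsGalois F K] [FiniteDimensional F V]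
    {ρ : Representation F G W} {τ : Representation K G V}
    (hρ : RepIndecomposable ρ) (hτ : RepIndecomposable τ)
    (h : RepSummand τ (repBaseChange K ρ))
    {U : Type*} [AddCommGroup U] [Module K U] [FiniteDimensional K U] {υ : Representation K G U}
    (hυ : RepIndecomposable υ) (h' : RepSummand υ (repBaseChange K ρ)) :
    ∃ σ : K ≃ₐ[F] K, RepIso (repTwist τ σ.toRingEquiv.toRingHom) υ := by
  have := hτ.1
  obtain ⟨f, g, hgf⟩ := exists_retract_repRes hρ h
  obtain ⟨i, q, hiq⟩ := exists_sum_conj_eq f g hgf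
  obtain ⟨r, s, hrs⟩ := repSummand_iff.1 h'
  let R := MonoidAlgebra K G
  have : Nontrivial υ.asModule := hυ.1
  have : IsArtinian R υ.asModule := isArtinian_of_tower K inferInstance
  have : IsNoetherian R υ.asModule := isNoetherian_of_tower K inferInstance
  obtain ⟨σ, hσ⟩ := exists_bijective_of_sum_comp_eq_id (R := R) hυ.2
    (Y := fun σ : K ≃ₐ[F] K => (repTwist τ σ.toRingEquiv.toRingHom).asModule)
    (fun σ => (hτ.twist σ.toRingEquiv).2)
    (fun σ => IntertwiningMap.equivLinearMapAsModule _ _ ((conjFrom σ q).comp r))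
    (fun σ => IntertwiningMap.equivLinearMapAsModule _ _ (s.comp (conjInto σ i))) fun x => by
      have h1 := congrArg s.toLinearMap (hiq (r x))
      rw [map_sum] at h1
      exact h1.trans (hrs x)
  exact ⟨σ, ⟨(LinearEquiv.ofBijective _ hσ).symm⟩⟩

end Galois

/-- Let `F = 𝔽_p`, `K` a finite extension of `F`, `W` an indecomposable `FG`-module and `V` an
indecomposable `KG`-module with `V | W ⊗_F K`.  Then (i) `V^σ | W ⊗_F K` for every field
automorphism `σ` of `K`, and (ii) every indecomposable `KG`-module `U` with `U | W ⊗_F K` is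
isomorphic to `V^σ` for some field automorphism `σ` of `K`. -/
theorem twists_exhaust_summands_of_baseChange (p : ℕ) [Fact p.Prime]
    (K : Type) [Field K] [Algebra (ZMod p) K] [FiniteDimensional (ZMod p) K]
    (G : Type) [Group G] [Finite G]
    (W : Type) [AddCommGroup W] [Module (ZMod p) W] [FiniteDimensional (ZMod p) W]
    (ρW : Representation (ZMod p) G W) (hW : RepIndecomposable ρW)
    (V : Type) [AddCommGroup V] [Module K V] [FiniteDimensional K V]
    (ρV : Representation K G V) (hV : RepIndecomposable ρV)
    (hVW : RepSummand ρV (repBaseChange K ρW)) :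
    (∀ σ : K ≃+* K, RepSummand (repTwist ρV σ.toRingHom) (repBaseChange K ρW)) ∧
    (∀ (U : Type) [AddCommGroup U] [Module K U] [FiniteDimensional K U]
        (ρU : Representation K G U), RepIndecomposable ρU →
        RepSummand ρU (repBaseChange K ρW) →
        ∃ σ : K ≃+* K, RepIso (repTwist ρV σ.toRingHom) ρU) := by
  have : Finite K := Module.finite_of_finite (ZMod p)
  have : IsGalois (ZMod p) K := inferInstance
  let _ : Module (ZMod p) V := Module.compHom V (algebraMap (ZMod p) K)
  have : IsScalarTower (ZMod p) K V :=
    ⟨fun a b v => by rw [Algebra.smul_def, mul_smul]; rfl⟩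
  have : FiniteDimensional (ZMod p) V := Module.Finite.trans K V
  refine ⟨fun σ => ?_, fun U _ _ _ ρU hU hUW => ?_⟩
  · exact hVW.twist (AlgEquiv.ofRingEquiv (f := σ) fun x =>
      RingHom.congr_fun (Subsingleton.elim (σ.toRingHom.comp (algebraMap (ZMod p) K)) _) x)
  · obtain ⟨σ, hσ⟩ := exists_repIso_twist hW hV hVW hU hUW
    exact ⟨σ.toRingEquiv, hσ⟩
end

section
/- Let p be a prime, F = 𝔽_p, F̄ an algebraic closure of F, G a finite group, K a finite subfield of F̄, W a simple FG-module, and V an indecomposable KG-module with V | W ⊗_F K. If the F̄G-module V ⊗_K F̄ is indecomposable, then V ⊗_K F̄ is a simple F̄G-module. -/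
set_option synthInstance.maxHeartbeats 1600000
set_option maxHeartbeats 1600000

open TensorProduct

open Representation in
/-- A semilinear map commuting with the actions of `G` is semilinear over the group algebras. -/
noncomputable def asModuleSemilinearMap {R S G : Type*} [CommSemiring R] [CommSemiring S]
    [Monoid G] {φ : R →+* S} {V W : Type*} [AddCommMonoid V] [Module R V] [AddCommMonoid W]
    [Module S W] (ρ : Representation R G V) (τ : Representation S G W) (f : V →ₛₗ[φ] W)
    (hf : ∀ g v, f (ρ g v) = τ g (f v)) :
    ρ.asModule →ₛₗ[MonoidAlgebra.mapRingHom G φ] τ.asModule where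
  toFun v := τ.asModuleEquiv.symm (f (ρ.asModuleEquiv v))
  map_add' v w := by simp
  map_smul' r v := by
    induction r using MonoidAlgebra.induction_linear with
    | zero => simp
    | add x y hx hy => simp only [add_smul, map_add, hx, hy]
    | single g a =>
      rw [MonoidAlgebra.mapRingHom_single]
      simp only [asModuleEquiv_map_smul, asAlgebraHom_single, LinearMap.smul_apply,
        LinearMap.map_smulₛₗ, hf, LinearEquiv.symm_apply_eq, LinearEquiv.apply_symm_apply]

theorem repBaseChange_apply_tmul {k L G V : Type*} [CommRing k] [CommRing L] [Algebra k L]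
    [Monoid G] [AddCommGroup V] [Module k V] (ρ : Representation k G V) (g : G) (a : L) (v : V) :
    repBaseChange L ρ g (a ⊗ₜ[k] v) = a ⊗ₜ[k] ρ g v := rfl

/-- The semilinear action of an automorphism of `L` on `L ⊗[k] V`, through the first factor. -/
noncomputable def galoisTensor {k L : Type*} [CommSemiring k] [CommSemiring L] [Algebra k L]
    (V : Type*) [AddCommMonoid V] [Module k V] (σ : L ≃ₐ[k] L) :
    L ⊗[k] V →ₛₗ[(σ : L →+* L)] L ⊗[k] V where
  toFun := σ.toLinearMap.rTensor V
  map_add' := map_add _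
  map_smul' a x := by
    induction x with
    | zero => simp
    | add x y hx hy => simp only [smul_add, map_add, hx, hy]
    | tmul b v => simp [smul_tmul']

@[simp]
theorem galoisTensor_tmul {k L V : Type*} [CommSemiring k] [CommSemiring L] [Algebra k L]
    [AddCommMonoid V] [Module k V] (σ : L ≃ₐ[k] L) (a : L) (v : V) :
    galoisTensor V σ (a ⊗ₜ v) = σ a ⊗ₜ v := rfl

theorem galoisTensor_bijective {k L : Type*} [CommSemiring k] [CommSemiring L] [Algebra k L]
    (V : Type*) [AddCommMonoid V] [Module k V] (σ : L ≃ₐ[k] L) :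
    Function.Bijective (galoisTensor V σ) :=
  (σ.toLinearEquiv.rTensor V).bijective

theorem baseChange_repr_galoisTensor {k L V ι : Type*} [CommRing k] [CommRing L] [Algebra k L]
    [AddCommGroup V] [Module k V] (b : Module.Basis ι k V) (σ : L ≃ₐ[k] L) (x : L ⊗[k] V) (i : ι) :
    (b.baseChange L).repr (galoisTensor V σ x) i = σ ((b.baseChange L).repr x i) := by
  induction x with
  | zero => simp
  | add x y hx hy => simp only [map_add, Finsupp.add_apply, hx, hy]
  | tmul a v => simp [Module.Basis.baseChange_repr_tmul]

/-- A nonzero Galois-stable subspace of `L ⊗[k] V` contains a nonzero vector defined over `k`. -/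
theorem exists_one_tmul_mem_of_galoisTensor_stable {k L V : Type*} [Field k] [Field L]
    [Algebra k L] [IsGalois k L] [AddCommGroup V] [Module k V] (S : Submodule L (L ⊗[k] V))
    (hS : S ≠ ⊥) (hstable : ∀ (σ : L ≃ₐ[k] L), ∀ x ∈ S, galoisTensor V σ x ∈ S) :
    ∃ v : V, v ≠ 0 ∧ (1 : L) ⊗ₜ[k] v ∈ S := by
  classical
  let b := Module.Basis.ofVectorSpace k V
  let B := b.baseChange L
  obtain ⟨x₀, hx₀, hmin⟩ := WellFounded.has_min
    (measure fun x : L ⊗[k] V ↦ (B.repr x).support.card).wf {x | x ∈ S ∧ x ≠ 0}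
    ((Submodule.ne_bot_iff S).1 hS)
  obtain ⟨i, hi⟩ := Finsupp.ne_iff.1 ((map_ne_zero_iff _ B.repr.injective).2 hx₀.2)
  rw [Finsupp.coe_zero, Pi.zero_apply] at hi
  set x := (B.repr x₀ i)⁻¹ • x₀ with hx
  have hxS : x ∈ S := S.smul_mem _ hx₀.1
  have hxi : B.repr x i = 1 := by simp [hx, hi]
  have hsupp : (B.repr x).support ⊆ (B.repr x₀).support := by
    rw [hx, map_smul]; exact Finsupp.support_smul
  have hfix (σ : L ≃ₐ[k] L) : galoisTensor V σ x = x := by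
    by_contra hne
    refine hmin (galoisTensor V σ x - x)
      ⟨S.sub_mem (hstable σ x hxS) hxS, sub_ne_zero.2 hne⟩ (Finset.card_lt_card ?_)
    refine (Finset.ssubset_iff_of_subset fun j hj ↦ ?_).2 ⟨i, by simpa using hi, ?_⟩
    · by_contra hj'
      have h0 : B.repr x j = 0 := Finsupp.notMem_support_iff.1 fun h ↦ hj' (hsupp h)
      simp [B, baseChange_repr_galoisTensor, show (b.baseChange L).repr x j = 0 from h0] at hj
    · simp [B, baseChange_repr_galoisTensor, show (b.baseChange L).repr x i = 1 from hxi]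
  have hrange (j) : ∃ c : k, algebraMap k L c = B.repr x j := by
    refine IntermediateField.mem_bot.1 ((InfiniteGalois.mem_bot_iff_fixed _).2 fun σ ↦ ?_)
    rw [← baseChange_repr_galoisTensor, hfix]
  choose c hc using hrange
  let v := b.repr.symm (Finsupp.onFinset (B.repr x).support c fun j hj ↦ by
    simpa [← hc] using hj)
  have hv : (1 : L) ⊗ₜ[k] v = x := by
    refine B.repr.injective (Finsupp.ext fun j ↦ ?_)
    simp [B, v, Module.Basis.baseChange_repr_tmul, Algebra.smul_def, hc]
  refine ⟨v, fun h ↦ ?_, hv ▸ hxS⟩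
  rw [← hv, h] at hxi
  simp at hxi

/-- Simple representations become semisimple after a Galois extension of the base field. -/
theorem isSemisimpleModule_repBaseChange {k L G V : Type*} [Field k] [Field L] [Algebra k L]
    [IsGalois k L] [Group G] [AddCommGroup V] [Module k V] [FiniteDimensional k V]
    (ρ : Representation k G V) (hρ : RepSimple ρ) :
    IsSemisimpleModule (MonoidAlgebra L G) (repBaseChange L ρ).asModule := by
  have : IsSimpleModule (MonoidAlgebra k G) ρ.asModule := hρ
  have : Nontrivial V := IsSimpleModule.nontrivial (MonoidAlgebra k G) ρ.asModule
  have : Nontrivial (repBaseChange L ρ).asModule := inferInstanceAs (Nontrivial (L ⊗[k] V))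
  have : IsArtinian (MonoidAlgebra L G) (repBaseChange L ρ).asModule :=
    isArtinian_of_tower L (inferInstanceAs (IsArtinian L (L ⊗[k] V)))
  let S := sSup {A : Submodule (MonoidAlgebra L G) (repBaseChange L ρ).asModule | IsAtom A}
  have hS : S ≠ ⊥ := by
    obtain ⟨A, hA⟩ := IsAtomic.exists_atom
      (Submodule (MonoidAlgebra L G) (repBaseChange L ρ).asModule)
    exact ne_bot_of_le_ne_bot hA.1 (le_sSup hA)
  let ι := asModuleSemilinearMap (φ := algebraMap k L) ρ (repBaseChange L ρ)
    { toFun := fun v ↦ 1 ⊗ₜ v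
      map_add' := tmul_add 1
      map_smul' := fun a v ↦ by simp [smul_tmul', Algebra.algebraMap_eq_smul_one] } fun g v ↦ rfl
  have hcomap : S.comap ι ≠ ⊥ := by
    obtain ⟨v, hv, hvS⟩ := exists_one_tmul_mem_of_galoisTensor_stable (k := k) (V := V)
      (S.restrictScalars L) (mt (Submodule.restrictScalars_eq_bot_iff _ _ _).1 hS) fun σ x hx ↦ by
        let e := asModuleSemilinearMap (repBaseChange L ρ) (repBaseChange L ρ)
          (galoisTensor V σ) fun g x ↦ by
            induction x with
            | zero => simp
            | add x y hx hy => simp only [map_add, hx, hy]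
            | tmul a v => rfl
        have : RingHomSurjective (MonoidAlgebra.mapRingHom G (σ : L →+* L)) :=
          ⟨MonoidAlgebra.map_surjective (σ : L →+* L).toAddMonoidHom σ.surjective⟩
        let E := Submodule.orderIsoMapComapOfBijective e (galoisTensor_bijective V σ)
        have hE : E S = S := by
          change E (sSup _) = sSup _
          rw [E.map_sSup, ← sSup_image]
          congr 1
          ext A
          refine ⟨?_, fun hA ↦ ⟨E.symm A, (E.symm.isAtom_iff A).2 hA, E.apply_symm_apply A⟩⟩
          rintro ⟨A, hA, rfl⟩
          exact (E.isAtom_iff A).2 hA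
        have : e x ∈ S := hE ▸ Submodule.mem_map_of_mem hx
        exact this
    exact (Submodule.ne_bot_iff _).2 ⟨v, hvS, hv⟩
  have htop : S.comap ι = ⊤ := (eq_bot_or_eq_top _).resolve_left hcomap
  have hStop : S.restrictScalars L = ⊤ := by
    rw [eq_top_iff]
    rintro x -
    change L ⊗[k] V at x
    induction x with
    | zero => exact Submodule.zero_mem _
    | add x y hx hy => exact Submodule.add_mem _ hx hy
    | tmul a v =>
      have hv : ι v ∈ S := Submodule.mem_comap.1 (htop ▸ Submodule.mem_top)
      have ha : a • ((1 : L) ⊗ₜ[k] v) = a ⊗ₜ[k] v := by rw [smul_tmul', smul_eq_mul, mul_one]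
      exact ha ▸ (S.restrictScalars L).smul_mem a hv
  exact IsSemisimpleModule.of_sSup_simples_eq_top <|
    (congrArg sSup (Set.ext fun A ↦ isSimpleModule_iff_isAtom)).trans
      ((Submodule.restrictScalars_eq_top_iff L _ _).1 hStop)

theorem cancelBaseChange_repBaseChange {k K L G V : Type*} [CommRing k] [CommRing K] [CommRing L]
    [Algebra k K] [Algebra k L] [Algebra K L] [IsScalarTower k K L] [Monoid G] [AddCommGroup V]
    [Module k V] (ρ : Representation k G V) (g : G) (x : L ⊗[K] (K ⊗[k] V)) :
    AlgebraTensorModule.cancelBaseChange k K L L V (repBaseChange L (repBaseChange K ρ) g x) =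
      repBaseChange L ρ g (AlgebraTensorModule.cancelBaseChange k K L L V x) := by
  induction x with
  | zero => simp
  | add x y hx hy => simp only [map_add, hx, hy]
  | tmul a y =>
    induction y with
    | zero => simp
    | add x y hx hy => simp only [tmul_add, map_add, hx, hy]
    | tmul b v => simp [repBaseChange_apply_tmul]

/-- The base change of an intertwining map. -/
noncomputable def Representation.IntertwiningMap.baseChange {k G V W : Type*} (L : Type*)
    [CommRing k] [CommRing L] [Algebra k L] [Monoid G] [AddCommGroup V] [Module k V]
    [AddCommGroup W] [Module k W] {ρ : Representation k G V} {τ : Representation k G W}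
    (f : IntertwiningMap ρ τ) : IntertwiningMap (repBaseChange L ρ) (repBaseChange L τ) where
  toLinearMap := f.toLinearMap.baseChange L
  isIntertwining' g := by
    refine LinearMap.ext fun x ↦ ?_
    induction x with
    | zero => simp
    | add x y hx hy => simp only [map_add, hx, hy]
    | tmul a v =>
      simp [repBaseChange_apply_tmul, f.isIntertwining]

theorem RepIndecomposable.repSimple {k G V : Type*} [CommRing k] [Monoid G] [AddCommGroup V]
    [Module k V] {ρ : Representation k G V} (h : RepIndecomposable ρ)
    [IsSemisimpleModule (MonoidAlgebra k G) ρ.asModule] : RepSimple ρ := by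
  have : Nontrivial ρ.asModule := h.1
  refine (isSimpleModule_iff _ _).2 { eq_bot_or_eq_top := fun A ↦ ?_ }
  obtain ⟨B, hAB⟩ := exists_isCompl A
  exact (h.2 A B hAB).imp_right fun hB ↦ by simpa [hB] using hAB.sup_eq_top

/-- Let `F = 𝔽_p`, `F̄` an algebraic closure of `F`, `K` a finite subfield of `F̄`, `W` a simple
`FG`-module and `V` an indecomposable `KG`-module with `V | W ⊗_F K`.  If `V ⊗_K F̄` is
indecomposable, then it is a simple `F̄G`-module. -/
theorem simple_baseChange_algClosure_of_indecomposable (p : ℕ) [Fact p.Prime]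
    (G : Type) [Group G] [Finite G]
    (K : IntermediateField (ZMod p) (AlgebraicClosure (ZMod p))) [Finite ↥K]
    (W : Type) [AddCommGroup W] [Module (ZMod p) W] [FiniteDimensional (ZMod p) W]
    (ρW : Representation (ZMod p) G W) (hW : RepSimple ρW)
    (V : Type) [AddCommGroup V] [Module ↥K V] [FiniteDimensional ↥K V]
    (ρV : Representation ↥K G V) (hV : RepIndecomposable ρV)
    (hVW : RepSummand ρV (repBaseChange ↥K ρW))
    (hind : RepIndecomposable (repBaseChange (AlgebraicClosure (ZMod p)) ρV)) :
    RepSimple (repBaseChange (AlgebraicClosure (ZMod p)) ρV) := by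
  obtain ⟨A, B, -, ⟨e⟩⟩ := hVW
  have := isSemisimpleModule_repBaseChange (L := AlgebraicClosure (ZMod p)) ρW hW
  let f := (Representation.IntertwiningMap.equivLinearMapAsModule ρV (repBaseChange ↥K ρW)).symm
    (A.subtype ∘ₗ e.toLinearMap)
  have hf : Function.Injective f.toLinearMap := A.subtype_injective.comp e.injective
  let h : Representation.IntertwiningMap (repBaseChange (AlgebraicClosure (ZMod p)) ρV)
      (repBaseChange (AlgebraicClosure (ZMod p)) ρW) :=
    { toLinearMap := (AlgebraTensorModule.cancelBaseChange (ZMod p) ↥K _ _ W).toLinearMap ∘ₗ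
        (f.baseChange (AlgebraicClosure (ZMod p))).toLinearMap
      isIntertwining' := fun g ↦ LinearMap.ext fun x ↦ by
        simp [Representation.IntertwiningMap.isIntertwining, cancelBaseChange_repBaseChange] }
  have hh : Function.Injective h :=
    (AlgebraTensorModule.cancelBaseChange (ZMod p) ↥K _ _ W).injective.comp
      (Module.Flat.lTensor_preserves_injective_linearMap _ hf)
  let F := Representation.IntertwiningMap.equivLinearMapAsModule
    (repBaseChange (AlgebraicClosure (ZMod p)) ρV) (repBaseChange (AlgebraicClosure (ZMod p)) ρW) h
  have := IsSemisimpleModule.of_injective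
    (N := (repBaseChange (AlgebraicClosure (ZMod p)) ρV).asModule)
    (M := (repBaseChange (AlgebraicClosure (ZMod p)) ρW).asModule)
    { toFun := F, map_add' := F.map_add', map_smul' := F.map_smul' } hh
  exact hind.repSimple
end
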